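/- For all integers m, n, t > 0 and all rational numbers x, y, the following identity holds in ℚ: Σ_{S ∈ S(m,n,t)} x^{dg(S)} · y^{cd(S)} = Σ_{P ∈ D(m,n,t)} (x+1)^{val(P)−ret(P)} · (xy+1)^{ret(P)}. (Note that ret(P) ≤ val(P) for every P, since every return is a valley, so the exponent val(P)−ret(P) is a nonnegative integer.) -/

import Mathlib

/-- A step of a lattice path: north `(0,1)`, east `(1,0)` or diagonal `(1,1)`. -/
inductive Step : Type
  | N : Step
  | E : Step
  | D : Step
  deriving DecidableEq

/-- The displacement vector of a step. -/
def stepVec : Step → ℤ × ℤ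
  | .N => (0, 1)
  | .E => (1, 0)
  | .D => (1, 1)

/-- The lattice point reached after the first `k` steps of the path `P` (starting at the
origin). -/
def pt (P : List Step) (k : ℕ) : ℤ × ℤ := ((P.take k).map stepVec).sum

/-- The path `P` starts with at least `t` north steps. -/
def StartsNorth (t : ℤ) (P : List Step) : Prop := List.replicate t.toNat Step.N <+: P

/-- The path `P` stays weakly above the line `x = m·y`. -/
def AboveLine (m : ℤ) (P : List Step) : Prop := ∀ k : ℕ, (pt P k).1 ≤ m * (pt P k).2

/-- An `(m,t)`-Schröder path of height `n`: a lattice path from `(0,0)` to `(mn,n)` using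
north, east and diagonal steps, starting with at least `t` north steps and never going
below the line `x = m·y`. -/
def IsSchroeder (m n t : ℤ) (P : List Step) : Prop :=
  StartsNorth t P ∧ pt P P.length = (m * n, n) ∧ AboveLine m P

/-- An `(m,t)`-Dyck path of height `n`: an `(m,t)`-Schröder path of height `n` with no
diagonal steps. -/
def IsDyck (m n t : ℤ) (P : List Step) : Prop :=
  IsSchroeder m n t P ∧ ∀ s ∈ P, s ≠ Step.D

/-- A Schröder path is small if none of its diagonal steps starts on the line `x = m·y`. -/
def IsSmall (m : ℤ) (P : List Step) : Prop :=
  ∀ j : ℕ, P[j]? = some Step.D → (pt P j).1 ≠ m * (pt P j).2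

/-- A Schröder path is positive if it touches the line `x = m·y` only at its two
endpoints. -/
def IsPositive (m : ℤ) (P : List Step) : Prop :=
  ∀ k : ℕ, 0 < k → k < P.length → (pt P k).1 ≠ m * (pt P k).2

/-- The set of indices `j` such that the `j`-th step of `P` is east and the `(j+1)`-st is
north; the corresponding valley point is `pt P (j+1)`. -/
def valleys (P : List Step) : Finset ℕ :=
  (Finset.range P.length).filter fun j => P[j]? = some Step.E ∧ P[j + 1]? = some Step.N

/-- The number of valleys of `P`. -/
def val (P : List Step) : ℕ := (valleys P).card

/-- The number of valleys of `P` whose `x`-coordinate is congruent to `i` modulo `m`. -/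
def ival (m i : ℤ) (P : List Step) : ℕ :=
  ((valleys P).filter fun j => (pt P (j + 1)).1 % m = i % m).card

/-- The set of returns of `P`: valleys of the form `(m·i, i)`. -/
def returns (m : ℤ) (P : List Step) : Finset ℕ :=
  (valleys P).filter fun j => (pt P (j + 1)).1 = m * (pt P (j + 1)).2

/-- The number of returns of `P`. -/
def ret (m : ℤ) (P : List Step) : ℕ := (returns m P).card

/-- The set of indices of diagonal steps of `P`. -/
def diags (P : List Step) : Finset ℕ :=
  (Finset.range P.length).filter fun j => P[j]? = some Step.D

/-- The number of diagonal steps of `P`. -/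
def dg (P : List Step) : ℕ := (diags P).card

/-- A Schröder path is `m`-divisible if every diagonal step ends at an `x`-coordinate
divisible by `m`. -/
def MDivisible (m : ℤ) (P : List Step) : Prop :=
  ∀ j ∈ diags P, m ∣ (pt P (j + 1)).1

/-- The number of cornered diagonal steps of `P`: diagonal steps connecting `(i·m − 1, i)`
to `(i·m, i + 1)` for some `i`. -/
def cd (m : ℤ) (P : List Step) : ℕ :=
  ((diags P).filter fun j => (pt P (j + 1)).1 = m * ((pt P (j + 1)).2 - 1)).card

/-- The generalized binomial coefficient `C(p,q) = p(p−1)⋯(p−q+1)/q!` for integers `p` and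
`q ≥ 0`, and `C(p,q) = 0` for `q < 0`. -/
def C (p q : ℤ) : ℤ :=
  if q < 0 then 0
  else if 0 ≤ p then (p.toNat.choose q.toNat : ℤ)
  else (-1) ^ q.toNat * ((q - p - 1).toNat.choose q.toNat : ℤ)

instance : Fintype Step := ⟨{.N, .E, .D}, fun s => by cases s <;> decide⟩

@[simp] lemma pt_zero (P : List Step) : pt P 0 = 0 := by simp [pt]

@[simp] lemma pt_cons_succ (s : Step) (P : List Step) (k : ℕ) :
    pt (s :: P) (k + 1) = stepVec s + pt P k := by simp [pt]

lemma pt_length (P : List Step) : pt P P.length = (P.map stepVec).sum := by simp [pt]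

/-- Replace every diagonal step by an east step followed by a north step. -/
def expand : List Step → List Step
  | [] => []
  | .D :: S => .E :: .N :: expand S
  | .N :: S => .N :: expand S
  | .E :: S => .E :: expand S

/-- The paths obtained from `P` by contracting a set of valleys to diagonal steps. -/
def contractions : List Step → Finset (List Step)
  | [] => {[]}
  | .E :: .N :: P =>
    (contractions P).image (fun S => .D :: S) ∪ (contractions P).image (fun S => .E :: .N :: S)
  | s :: P => (contractions P).image (fun S => s :: S)

lemma not_D_of_mem_expand (S : List Step) : ∀ s ∈ expand S, s ≠ Step.D := by
  fun_induction expand S <;> simp_all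

lemma mem_contractions_iff {P : List Step} (hP : ∀ s ∈ P, s ≠ Step.D) (S : List Step) :
    S ∈ contractions P ↔ expand S = P := by
  fun_induction contractions P generalizing S with
  | case1 => cases S with
    | nil => simp [expand]
    | cons s S => cases s <;> simp [expand]
  | case2 P ih =>
    have ih := ih (fun s hs => hP s (by simp [hs]))
    rcases S with _ | ⟨_ | _ | _, _ | ⟨_ | _ | _, S⟩⟩ <;> simp [expand, ih]
  | case3 s P hne ih =>
    have ih := ih (fun s hs => hP s (by simp [hs]))
    have hs := hP s (by simp)
    rcases S with _ | ⟨a, S⟩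
    · simp [expand]
    · cases a
      · simp [expand, ih]
        tauto
      · simp [expand, ih]
        tauto
      · simp only [Finset.mem_image, List.cons.injEq, expand]
        constructor
        · rintro ⟨_, _, h, _⟩
          exact absurd h hs
        · rintro ⟨h, h'⟩
          exact (hne _ h.symm h'.symm).elim

lemma sum_stepVec_expand (S : List Step) :
    ((expand S).map stepVec).sum = (S.map stepVec).sum := by
  fun_induction expand S <;> simp_all [stepVec, ← add_assoc]

lemma replicate_N_prefix_expand_iff (k : ℕ) (S : List Step) :
    List.replicate k Step.N <+: expand S ↔ List.replicate k Step.N <+: S := by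
  induction k generalizing S with
  | zero => simp
  | succ k ih =>
    rcases S with _ | ⟨_ | _ | _, S⟩ <;>
      simp [expand, List.replicate_succ, List.cons_prefix_cons, ih]

/-- The path `S`, started at the point `p`, stays weakly above the line `x = m·y` and has no
diagonal step starting on it. -/
def IsSmallAboveFrom (m : ℤ) : ℤ × ℤ → List Step → Prop
  | p, [] => p.1 ≤ m * p.2
  | p, s :: S => p.1 ≤ m * p.2 ∧ (s = .D → p.1 ≠ m * p.2) ∧ IsSmallAboveFrom m (p + stepVec s) S

lemma isSmallAboveFrom_iff (m : ℤ) (p : ℤ × ℤ) (S : List Step) :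
    IsSmallAboveFrom m p S ↔ (∀ k, (p + pt S k).1 ≤ m * (p + pt S k).2) ∧
      ∀ j, S[j]? = some Step.D → (p + pt S j).1 ≠ m * (p + pt S j).2 := by
  induction S generalizing p with
  | nil => simp [IsSmallAboveFrom, pt]
  | cons s S ih =>
    rw [IsSmallAboveFrom, ih]
    constructor
    · rintro ⟨h, hD, h1, h2⟩
      refine ⟨fun k => ?_, fun j hj => ?_⟩
      · cases k with
        | zero => simpa using h
        | succ k => simpa [add_assoc] using h1 k
      · cases j with
        | zero => simpa using hD (by simpa using hj)
        | succ j => simpa [add_assoc] using h2 j (by simpa using hj)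
    · rintro ⟨h1, h2⟩
      refine ⟨by simpa using h1 0, fun h => by simpa using h2 0 (by simp [h]), fun k => ?_,
        fun j hj => ?_⟩
      · simpa [add_assoc] using h1 (k + 1)
      · simpa [add_assoc] using h2 (j + 1) (by simpa using hj)

lemma isSmallAboveFrom_expand_iff (m : ℤ) (p : ℤ × ℤ) (S : List Step) :
    IsSmallAboveFrom m p (expand S) ↔ IsSmallAboveFrom m p S := by
  fun_induction expand S generalizing p with
  | case1 => rfl
  | case2 S ih =>
    have h : p + stepVec .E + stepVec .N = p + stepVec .D := by simp [stepVec, add_assoc]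
    simp only [IsSmallAboveFrom, h, ih]
    simp only [reduceCtorEq, false_implies, true_and, forall_const]
    simp only [stepVec, Prod.fst_add, Prod.snd_add, add_zero, ← and_assoc]
    refine and_congr_left fun _ => ?_
    omega
  | case3 S ih => simp [IsSmallAboveFrom, ih]
  | case4 S ih => simp [IsSmallAboveFrom, ih]

lemma isDyck_expand_iff (m n t : ℤ) (S : List Step) :
    IsDyck m n t (expand S) ↔ IsSchroeder m n t S ∧ IsSmall m S := by
  have key := isSmallAboveFrom_expand_iff m 0 S
  rw [isSmallAboveFrom_iff, isSmallAboveFrom_iff] at key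
  simp only [zero_add] at key
  have hD := not_D_of_mem_expand S
  have hsmall : IsSmall m (expand S) := fun j hj => (hD _ (List.mem_of_getElem? hj) rfl).elim
  simp only [IsDyck, IsSchroeder, StartsNorth, replicate_N_prefix_expand_iff, pt_length,
    sum_stepVec_expand]
  simp only [AboveLine, IsSmall] at hsmall ⊢
  tauto

lemma finite_isDyck (m n t : ℤ) : {P : List Step | IsDyck m n t P}.Finite := by
  refine (List.finite_length_le Step (m * n + n).toNat).subset ?_
  rintro P ⟨⟨-, h, -⟩, -⟩
  have key : ∀ P : List Step,
      (P.length : ℤ) ≤ (P.map stepVec).sum.1 + (P.map stepVec).sum.2 := by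
    intro P
    induction P with
    | nil => simp
    | cons s P ih => cases s <;> simp [stepVec] <;> omega
  have := key P
  rw [← pt_length, h] at this
  simp only [Set.mem_ofPred_eq]
  omega

lemma finite_isSchroeder_isSmall (m n t : ℤ) :
    {S : List Step | IsSchroeder m n t S ∧ IsSmall m S}.Finite := by
  refine ((finite_isDyck m n t).biUnion fun P _ => (contractions P).finite_toSet).subset ?_
  intro S hS
  refine Set.mem_biUnion ((isDyck_expand_iff m n t S).2 hS) ?_
  exact (mem_contractions_iff (not_D_of_mem_expand S) S).2 rfl

/-- The weight of a Schröder path started at `p`: a factor `x` for every diagonal step and a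
further factor `y` for every cornered one. -/
def diagWeight (m : ℤ) (x y : ℚ) : ℤ × ℤ → List Step → ℚ
  | _, [] => 1
  | p, s :: S => (if s = .D then (if p.1 + 1 = m * p.2 then x * y else x) else 1) *
      diagWeight m x y (p + stepVec s) S

/-- The weight of a Dyck path started at `p`: a factor `x * y + 1` for every return and a
factor `x + 1` for every other valley. -/
def valleyWeight (m : ℤ) (x y : ℚ) : ℤ × ℤ → List Step → ℚ
  | _, [] => 1
  | p, s :: P => (if s = .E ∧ P[0]? = some .N then
        (if p.1 + 1 = m * p.2 then x * y + 1 else x + 1) else 1) *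
      valleyWeight m x y (p + stepVec s) P

lemma sum_contractions_diagWeight (m : ℤ) (x y : ℚ) {P : List Step}
    (hP : ∀ s ∈ P, s ≠ Step.D) (p : ℤ × ℤ) :
    ∑ S ∈ contractions P, diagWeight m x y p S = valleyWeight m x y p P := by
  fun_induction contractions P generalizing p with
  | case1 => simp [diagWeight, valleyWeight]
  | case2 P ih =>
    have ih := ih (fun s hs => hP s (by simp [hs]))
    have h : p + stepVec .E + stepVec .N = p + stepVec .D := by simp [stepVec, add_assoc]
    rw [Finset.sum_union, Finset.sum_image (by simp), Finset.sum_image (by simp)]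
    · simp only [diagWeight, valleyWeight, h, ← Finset.mul_sum, ih]
      simp
      split_ifs <;> ring
    · rw [Finset.disjoint_left]
      simp
  | case3 s P hne ih =>
    have ih := ih (fun s hs => hP s (by simp [hs]))
    have hs := hP s (by simp)
    have hEN : ¬ (s = .E ∧ P[0]? = some .N) := by
      rintro ⟨h, h'⟩
      cases P with
      | nil => simp at h'
      | cons a P => exact hne P h (by simp_all)
    rw [Finset.sum_image (by simp)]
    simp only [diagWeight, valleyWeight, if_neg hs, if_neg hEN, one_mul, ih]

lemma prod_diags_cons (f : ℤ × ℤ → ℚ) (s : Step) (S : List Step) :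
    ∏ j ∈ diags (s :: S), f (pt (s :: S) (j + 1)) =
      (if s = .D then f (stepVec s) else 1) * ∏ j ∈ diags S, f (stepVec s + pt S (j + 1)) := by
  simp only [diags, Finset.prod_filter, List.length_cons, Finset.prod_range_succ']
  rw [mul_comm]
  simp

lemma prod_valleys_cons (f : ℤ × ℤ → ℚ) (s : Step) (P : List Step) :
    ∏ j ∈ valleys (s :: P), f (pt (s :: P) (j + 1)) =
      (if s = .E ∧ P[0]? = some .N then f (stepVec s) else 1) *
        ∏ j ∈ valleys P, f (stepVec s + pt P (j + 1)) := by
  simp only [valleys, Finset.prod_filter, List.length_cons, Finset.prod_range_succ']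
  rw [mul_comm]
  simp

lemma diagWeight_eq_prod (m : ℤ) (x y : ℚ) (p : ℤ × ℤ) (S : List Step) :
    diagWeight m x y p S = ∏ j ∈ diags S,
      if (p + pt S (j + 1)).1 = m * ((p + pt S (j + 1)).2 - 1) then x * y else x := by
  induction S generalizing p with
  | nil => simp [diagWeight, diags]
  | cons s S ih =>
    rw [prod_diags_cons (fun q => if (p + q).1 = m * ((p + q).2 - 1) then x * y else x),
      diagWeight, ih]
    simp only [add_assoc]
    congr 1
    cases s <;> simp [stepVec]

lemma valleyWeight_eq_prod (m : ℤ) (x y : ℚ) (p : ℤ × ℤ) (P : List Step) :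
    valleyWeight m x y p P = ∏ j ∈ valleys P,
      if (p + pt P (j + 1)).1 = m * (p + pt P (j + 1)).2 then x * y + 1 else x + 1 := by
  induction P generalizing p with
  | nil => simp [valleyWeight, valleys]
  | cons s P ih =>
    rw [prod_valleys_cons (fun q => if (p + q).1 = m * (p + q).2 then x * y + 1 else x + 1),
      valleyWeight, ih]
    simp only [add_assoc]
    congr 1
    cases s <;> simp [stepVec]

lemma diagWeight_zero (m : ℤ) (x y : ℚ) (S : List Step) :
    diagWeight m x y 0 S = x ^ dg S * y ^ cd m S := by
  have h (j : ℕ) : (if (pt S (j + 1)).1 = m * ((pt S (j + 1)).2 - 1) then x * y else x) =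
      x * if (pt S (j + 1)).1 = m * ((pt S (j + 1)).2 - 1) then y else 1 := by
    split_ifs <;> simp
  simp only [diagWeight_eq_prod, zero_add, h, Finset.prod_mul_distrib, Finset.prod_const,
    ← Finset.prod_filter]
  rfl

lemma valleyWeight_zero (m : ℤ) (x y : ℚ) (P : List Step) :
    valleyWeight m x y 0 P = (x + 1) ^ (val P - ret m P) * (x * y + 1) ^ ret m P := by
  have h := Finset.card_filter_add_card_filter_not (s := valleys P)
    (fun j => (pt P (j + 1)).1 = m * (pt P (j + 1)).2)
  have hval : val P - ret m P =
      ((valleys P).filter fun j => ¬ (pt P (j + 1)).1 = m * (pt P (j + 1)).2).card := by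
    rw [val, ret, returns, ← h, Nat.add_sub_cancel_left]
  rw [valleyWeight_eq_prod, hval]
  simp only [zero_add, Finset.prod_ite, Finset.prod_const]
  rw [mul_comm]
  rfl

/-- the diagonal/cornered-diagonal generating function of small
`(m,t)`-Schröder paths as a substitution of the valley-return generating function of
`(m,t)`-Dyck paths. -/
theorem statement18 (m n t : ℤ) (hm : 0 < m) (hn : 0 < n) (ht : 0 < t) (x y : ℚ) :
    (∑ᶠ S ∈ {S : List Step | IsSchroeder m n t S ∧ IsSmall m S},
        x ^ (dg S) * y ^ (cd m S))
      = ∑ᶠ P ∈ {P : List Step | IsDyck m n t P},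
          (x + 1) ^ (val P - ret m P) * (x * y + 1) ^ (ret m P) := by
  rw [finsum_mem_eq_finite_toFinset_sum _ (finite_isSchroeder_isSmall m n t),
    finsum_mem_eq_finite_toFinset_sum _ (finite_isDyck m n t)]
  rw [← Finset.sum_fiberwise_of_maps_to (g := expand) (t := (finite_isDyck m n t).toFinset)
    (fun S hS => by simpa [isDyck_expand_iff] using hS)]
  refine Finset.sum_congr rfl fun P hP => ?_
  rw [Set.Finite.mem_toFinset, Set.mem_ofPred_eq] at hP
  rw [← valleyWeight_zero, ← sum_contractions_diagWeight m x y hP.2]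
  refine Finset.sum_congr ?_ fun S _ => (diagWeight_zero m x y S).symm
  ext S
  rw [Finset.mem_filter, Set.Finite.mem_toFinset, Set.mem_ofPred_eq, ← isDyck_expand_iff,
    mem_contractions_iff hP.2]
  exact ⟨And.right, fun h => ⟨h ▸ hP, h⟩⟩
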